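/- With G, d, T, gᵢ and the notion of 3-word as in the context, the 𝔽₃-subspace of G spanned by all 3-words in which each of the letters g₀, g₁, g₂, g₃, g₄ occurs exactly once and the letter g₅ occurs exactly twice has 𝔽₃-dimension 5. -/

import Mathlib

/-- The Grassmann (exterior) algebra over `𝔽₃` of the free module with basis
indexed by `ℕ × ℕ`. -/
abbrev Gr : Type := ExteriorAlgebra (ZMod 3) ((ℕ × ℕ) →₀ ZMod 3)

/-- The generator `i^{(j)}` of the Grassmann algebra, i.e. `ι(e_{i,j})`. -/
noncomputable abbrev gen (i j : ℕ) : Gr :=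
  ExteriorAlgebra.ι (ZMod 3) (Finsupp.single (i, j) (1 : ZMod 3))

/-- `gᵢ = ι(e_{i,0})`. -/
noncomputable abbrev g (i : ℕ) : Gr := gen i 0

/-- `IsWord3 g T x L` : `x` is a 3-word, for the ternary operation `T`, in the
multiset of letters `L` (a multiset of indices of the generators `g`). Each
`g i` is a 3-word in the singleton multiset `{i}`, and if `u, v, w` are 3-words
in `L₁, L₂, L₃` then `T u v w` is a 3-word in `L₁ + L₂ + L₃`. -/
inductive IsWord3 {G : Type*} (g : ℕ → G) (T : G → G → G → G) : G → Multiset ℕ → Prop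
  | letter (i : ℕ) : IsWord3 g T (g i) {i}
  | node {u v w : G} {L₁ L₂ L₃ : Multiset ℕ} :
      IsWord3 g T u L₁ → IsWord3 g T v L₂ → IsWord3 g T w L₃ →
      IsWord3 g T (T u v w) (L₁ + L₂ + L₃)

open ExteriorAlgebra (ι ιMulti)

theorem ι_mul_ι_anticomm (v w : (ℕ × ℕ) →₀ ZMod 3) :
    ι (ZMod 3) v * ι (ZMod 3) w = -(ι (ZMod 3) w * ι (ZMod 3) v) :=
  eq_neg_of_add_eq_zero_left (ExteriorAlgebra.ι_add_mul_swap v w)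

theorem gen_mul_gen_self (i j : ℕ) : gen i j * gen i j = 0 :=
  ExteriorAlgebra.ι_sq_zero _

/-- Products of distinct generators do not vanish. -/
theorem ιMulti_single_ne_zero {n : ℕ} {m : Fin n → ℕ × ℕ} (hm : Function.Injective m) :
    ιMulti (ZMod 3) n (fun k => Finsupp.single (m k) (1 : ZMod 3)) ≠ 0 := by
  intro h
  let f : ((ℕ × ℕ) →₀ ZMod 3) [⋀^Fin n]→ₗ[ZMod 3] ZMod 3 :=
    Matrix.detRowAlternating.compLinearMap (LinearMap.pi fun k => Finsupp.lapply (m k))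
  have hf := congrArg (ExteriorAlgebra.liftAlternating (R := ZMod 3)
    (Function.update (fun _ => 0) n f)) h
  rw [ExteriorAlgebra.liftAlternating_apply_ιMulti, map_zero, Function.update_self] at hf
  have h1 : (fun r c => Finsupp.single (m r) (1 : ZMod 3) (m c)) =
      (1 : Matrix (Fin n) (Fin n) (ZMod 3)) := by
    ext r c
    simp [Finsupp.single_apply, Matrix.one_apply, hm.eq_iff]
  have : f (fun k => Finsupp.single (m k) (1 : ZMod 3)) =
      Matrix.det (1 : Matrix (Fin n) (Fin n) (ZMod 3)) := by
    rw [← h1]; rfl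
  rw [this, Matrix.det_one] at hf
  exact one_ne_zero hf

/-- The endomorphism of the space of generators sending `e_{i,j}` to `a i • e_{i,j+1}`. -/
noncomputable def shift (a : ℕ → ZMod 3) :
    ((ℕ × ℕ) →₀ ZMod 3) →ₗ[ZMod 3] ((ℕ × ℕ) →₀ ZMod 3) :=
  Finsupp.linearCombination (ZMod 3) fun p => a p.1 • Finsupp.single (p.1, p.2 + 1) (1 : ZMod 3)

/-- The algebra map `x ↦ x + ε D x` into the dual numbers, where `D` is the derivation extending
`shift a`. -/
noncomputable def dualShift (a : ℕ → ZMod 3) : Gr →ₐ[ZMod 3] TrivSqZeroExt Gr Gr :=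
  ExteriorAlgebra.lift (ZMod 3)
    ⟨{ toFun v := (ι (ZMod 3) v, ι (ZMod 3) (shift a v))
       map_add' v w := by simp only [map_add]; rfl
       map_smul' c v := by simp only [map_smul]; rfl }, fun v => by
      ext
      · exact ExteriorAlgebra.ι_sq_zero v
      · exact ExteriorAlgebra.ι_add_mul_swap v (shift a v)⟩

theorem fst_dualShift (a : ℕ → ZMod 3) (x : Gr) : (dualShift a x).fst = x := by
  induction x using ExteriorAlgebra.induction with
  | algebraMap r => rw [AlgHom.commutes]; rfl
  | ι v => rw [dualShift, ExteriorAlgebra.lift_ι_apply]; rfl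
  | mul x y hx hy => rw [map_mul, TrivSqZeroExt.fst_mul, hx, hy]
  | add x y hx hy => rw [map_add, TrivSqZeroExt.fst_add, hx, hy]

/-- The derivation of the Grassmann algebra sending `e_{i,j}` to `a i • e_{i,j+1}`. -/
noncomputable def weightedDer (a : ℕ → ZMod 3) : Gr →ₗ[ZMod 3] Gr where
  toFun x := (dualShift a x).snd
  map_add' x y := by rw [map_add, TrivSqZeroExt.snd_add]
  map_smul' c x := by rw [map_smul, TrivSqZeroExt.snd_smul]; rfl

theorem weightedDer_mul (a : ℕ → ZMod 3) (x y : Gr) :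
    weightedDer a (x * y) = weightedDer a x * y + x * weightedDer a y := by
  change (dualShift a (x * y)).snd = _
  rw [map_mul, TrivSqZeroExt.snd_mul, fst_dualShift, fst_dualShift, add_comm]
  rfl

theorem weightedDer_ι (a : ℕ → ZMod 3) (v : (ℕ × ℕ) →₀ ZMod 3) :
    weightedDer a (ι (ZMod 3) v) = ι (ZMod 3) (shift a v) := by
  change (dualShift a _).snd = _
  rw [dualShift, ExteriorAlgebra.lift_ι_apply]
  rfl

theorem weightedDer_algebraMap (a : ℕ → ZMod 3) (r : ZMod 3) :
    weightedDer a (algebraMap (ZMod 3) Gr r) = 0 := by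
  change (dualShift a _).snd = _
  rw [AlgHom.commutes]
  rfl

theorem weightedDer_gen (a : ℕ → ZMod 3) (i j : ℕ) :
    weightedDer a (gen i j) = a i • gen i (j + 1) := by
  rw [weightedDer_ι, ← map_smul]
  simp [shift]

theorem eq_weightedDer_one {d : Gr →ₗ[ZMod 3] Gr}
    (hLeib : ∀ u v : Gr, d (u * v) = d u * v + u * d v)
    (hd : ∀ i j : ℕ, d (gen i j) = gen i (j + 1)) : d = weightedDer 1 := by
  have h1 : d 1 = 0 := by simpa using hLeib 1 1
  have hι : d ∘ₗ ι (ZMod 3) = weightedDer 1 ∘ₗ ι (ZMod 3) := by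
    ext p : 2
    have := weightedDer_gen 1 p.1 p.2
    have := hd p.1 p.2
    simp_all
  refine LinearMap.ext fun x => ?_
  induction x using ExteriorAlgebra.induction with
  | algebraMap r =>
    rw [weightedDer_algebraMap, Algebra.algebraMap_eq_smul_one, map_smul, h1, smul_zero]
  | ι v => exact LinearMap.congr_fun hι v
  | mul x y hx hy => rw [hLeib, weightedDer_mul, hx, hy]
  | add x y hx hy => rw [map_add, map_add, hx, hy]

/-- Renaming the letter `6` into `5`. -/
def merge (i : ℕ) : ℕ := if i = 6 then 5 else i

/-- The endomorphism of the Grassmann algebra renaming the letter `6` into `5`. -/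
noncomputable def mergeHom : Gr →ₐ[ZMod 3] Gr :=
  ExteriorAlgebra.map (Finsupp.lmapDomain (ZMod 3) (ZMod 3) fun p : ℕ × ℕ => (merge p.1, p.2))

theorem mergeHom_gen (i j : ℕ) : mergeHom (gen i j) = gen (merge i) j := by
  simp [mergeHom]

theorem mergeHom_weightedDer_one (x : Gr) :
    mergeHom (weightedDer 1 x) = weightedDer 1 (mergeHom x) := by
  have hι : mergeHom.toLinearMap ∘ₗ weightedDer 1 ∘ₗ ι (ZMod 3) =
      weightedDer 1 ∘ₗ mergeHom.toLinearMap ∘ₗ ι (ZMod 3) := by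
    ext p : 2
    have := mergeHom_gen p.1 p.2
    have := mergeHom_gen p.1 (p.2 + 1)
    have := weightedDer_gen 1 p.1 p.2
    have := weightedDer_gen 1 (merge p.1) p.2
    simp_all
  induction x using ExteriorAlgebra.induction with
  | algebraMap r => rw [weightedDer_algebraMap, AlgHom.commutes, weightedDer_algebraMap, map_zero]
  | ι v => exact LinearMap.congr_fun hι v
  | mul x y hx hy => simp only [weightedDer_mul, map_mul, map_add, hx, hy]
  | add x y hx hy => simp only [map_add, hx, hy]

/-- The derivation sending `e_{i,j}` to `e_{i,j+1}`. -/
local notation "∂" => weightedDer 1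

/-- `x` anticommutes with all generators. -/
def Anti (x : Gr) : Prop := ∀ v, x * ι (ZMod 3) v = -(ι (ZMod 3) v * x)

theorem Anti.mul_mul {x y z : Gr} (hx : Anti x) (hy : Anti y) (hz : Anti z) :
    Anti (x * y * z) := fun v => by
  rw [mul_assoc, hz, mul_neg, ← mul_assoc, mul_assoc x y, hy, mul_neg, ← mul_assoc, hx]
  simp [mul_assoc]

theorem Anti.weightedDer {x : Gr} (hx : Anti x) (a : ℕ → ZMod 3) : Anti (weightedDer a x) := by
  intro v
  have h := congrArg (_root_.weightedDer a) (hx v)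
  rw [map_neg, weightedDer_mul, weightedDer_mul, weightedDer_ι, hx] at h
  rw [eq_sub_of_add_eq h]
  abel

theorem Anti.neg {x : Gr} (hx : Anti x) : Anti (-x) := fun v => by
  rw [neg_mul, hx, mul_neg]

/-- `x` is a 3-word in the letters `L`. -/
abbrev IsWord (x : Gr) (L : Multiset ℕ) : Prop :=
  IsWord3 g (fun a b c => -∂ (a * b * c)) x L

theorem IsWord.anti {x : Gr} {L : Multiset ℕ} (hx : IsWord x L) : Anti x := by
  induction hx with
  | letter i => exact fun v => ι_mul_ι_anticomm _ v
  | node _ _ _ hu hv hw => exact ((hu.mul_mul hv hw).weightedDer 1).neg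

theorem IsWord.anti_mul {y : Gr} {L : Multiset ℕ} (hy : IsWord y L) {x : Gr} (hx : Anti x) :
    x * y = -(y * x) := by
  induction hy generalizing x with
  | letter i => exact hx _
  | @node u v w _ _ _ _ _ _ hu hv hw =>
    have key : ∀ {x}, Anti x → x * (u * v * w) = -(u * v * w * x) := fun {x} hx => by
      rw [← mul_assoc, ← mul_assoc, hu hx, neg_mul, mul_assoc u, hv hx, mul_neg, neg_neg,
        mul_assoc, mul_assoc v, hw hx]
      simp [mul_assoc]
    have h := congrArg ∂ (key hx)
    rw [map_neg, weightedDer_mul _ x, weightedDer_mul _ _ x, key (hx.weightedDer 1)] at h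
    rw [mul_neg, eq_sub_of_add_eq' h]
    noncomm_ring

theorem IsWord.mul_comm {x y : Gr} {L L' : Multiset ℕ} (hx : IsWord x L) (hy : IsWord y L') :
    x * y = -(y * x) :=
  hy.anti_mul hx.anti

theorem IsWord.card_odd {x : Gr} {L : Multiset ℕ} (hx : IsWord x L) : L.card % 2 = 1 := by
  induction hx with
  | letter i => simp
  | node _ _ _ hu hv hw => simp only [Multiset.card_add]; omega

theorem IsWord.eq_of_card_one {x : Gr} {L : Multiset ℕ} (hx : IsWord x L) (hL : L.card = 1) :
    ∃ a, L = {a} ∧ x = g a := by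
  cases hx with
  | letter i => exact ⟨i, rfl, rfl⟩
  | node hu hv hw =>
    have := IsWord.card_odd hu
    have := IsWord.card_odd hv
    simp only [Multiset.card_add] at hL
    omega

theorem IsWord.eq_of_card_three {x : Gr} {L : Multiset ℕ} (hx : IsWord x L) (hL : L.card = 3) :
    ∃ a b c, L = {a, b, c} ∧ x = -∂ (g a * g b * g c) := by
  cases hx with
  | letter i => simp at hL
  | node hu hv hw =>
    have h1 := IsWord.card_odd hu
    have h2 := IsWord.card_odd hv
    have h3 := IsWord.card_odd hw
    simp only [Multiset.card_add] at hL
    obtain ⟨a, rfl, rfl⟩ := IsWord.eq_of_card_one hu (by omega)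
    obtain ⟨b, rfl, rfl⟩ := IsWord.eq_of_card_one hv (by omega)
    obtain ⟨c, rfl, rfl⟩ := IsWord.eq_of_card_one hw (by omega)
    exact ⟨a, b, c, rfl, rfl⟩

/-- Up to sign, the arguments of a composite word may be listed by decreasing length. -/
theorem IsWord.exists_node {x : Gr} {L : Multiset ℕ} (hx : IsWord x L) (hL : L.card ≠ 1) :
    ∃ u v w L₁ L₂ L₃, IsWord u L₁ ∧ IsWord v L₂ ∧ IsWord w L₃ ∧ L = L₁ + L₂ + L₃ ∧
      L₂.card ≤ L₁.card ∧ L₃.card ≤ L₂.card ∧ (x = ∂ (u * v * w) ∨ x = -∂ (u * v * w)) := by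
  cases hx with
  | letter i => simp at hL
  | @node u v w L₁ L₂ L₃ hu hv hw =>
    have huv : v * u * w = -(u * v * w) := by rw [IsWord.mul_comm hv hu, neg_mul]
    have hvw : u * w * v = -(u * v * w) := by
      rw [mul_assoc, IsWord.mul_comm hw hv, mul_neg, mul_assoc]
    have huvw : w * u * v = u * v * w := by
      rw [IsWord.mul_comm hw hu, neg_mul, hvw, neg_neg]
    have hvwu : v * w * u = u * v * w := by
      rw [mul_assoc, IsWord.mul_comm hw hu, mul_neg, ← mul_assoc, huv, neg_neg]
    have hwvu : w * v * u = -(u * v * w) := by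
      rw [IsWord.mul_comm hw hv, neg_mul, hvwu]
    rcases le_total L₁.card L₂.card with h12 | h12 <;>
    rcases le_total L₂.card L₃.card with h23 | h23 <;>
    rcases le_total L₁.card L₃.card with h13 | h13
    · exact ⟨w, v, u, _, _, _, hw, hv, hu, by abel, h23, h12, by simp [hwvu]⟩
    · exact ⟨w, v, u, _, _, _, hw, hv, hu, by abel, h23, h12, by simp [hwvu]⟩
    · exact ⟨v, w, u, _, _, _, hv, hw, hu, by abel, h23, h13, by simp [hvwu]⟩
    · exact ⟨v, u, w, _, _, _, hv, hu, hw, by abel, h12, h13, by simp [huv]⟩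
    · exact ⟨w, u, v, _, _, _, hw, hu, hv, by abel, h13, h12, by simp [huvw]⟩
    · exact ⟨u, w, v, _, _, _, hu, hw, hv, by abel, h13, h23, by simp [hvw]⟩
    · exact ⟨u, v, w, _, _, _, hu, hv, hw, rfl, h12, h23, by simp⟩
    · exact ⟨u, v, w, _, _, _, hu, hv, hw, rfl, h12, h23, by simp⟩

theorem IsWord.eq_of_card_five {x : Gr} {L : Multiset ℕ} (hx : IsWord x L) (hL : L.card = 5) :
    ∃ a b c e f, L = {a, b, c, e, f} ∧
      (x = ∂ (∂ (g a * g b * g c) * g e * g f) ∨ x = -∂ (∂ (g a * g b * g c) * g e * g f)) := by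
  obtain ⟨u, v, w, L₁, L₂, L₃, hu, hv, hw, rfl, h12, h23, h⟩ := hx.exists_node (by omega)
  have h1 := hu.card_odd
  have h2 := hv.card_odd
  have h3 := hw.card_odd
  simp only [Multiset.card_add] at hL
  obtain ⟨a, b, c, rfl, rfl⟩ := hu.eq_of_card_three (by omega)
  obtain ⟨e, rfl, rfl⟩ := hv.eq_of_card_one (by omega)
  obtain ⟨f, rfl, rfl⟩ := hw.eq_of_card_one (by omega)
  exact ⟨a, b, c, e, f, rfl, by simpa [or_comm] using h⟩

theorem IsWord.eq_of_card_seven {x : Gr} {L : Multiset ℕ} (hx : IsWord x L) (hL : L.card = 7) :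
    ∃ a b c e f h k, L = ↑[a, b, c, e, f, h, k] ∧
      ((x = ∂ (∂ (∂ (g a * g b * g c) * g e * g f) * g h * g k) ∨
          x = -∂ (∂ (∂ (g a * g b * g c) * g e * g f) * g h * g k)) ∨
        (x = ∂ (∂ (g a * g b * g c) * ∂ (g e * g f * g h) * g k) ∨
          x = -∂ (∂ (g a * g b * g c) * ∂ (g e * g f * g h) * g k))) := by
  obtain ⟨u, v, w, L₁, L₂, L₃, hu, hv, hw, rfl, h12, h23, hx⟩ := hx.exists_node (by omega)
  have h1 := hu.card_odd
  have h2 := hv.card_odd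
  have h3 := hw.card_odd
  simp only [Multiset.card_add] at hL
  obtain ⟨k, rfl, rfl⟩ := hw.eq_of_card_one (by omega)
  by_cases h5 : L₁.card = 5
  · obtain ⟨a, b, c, e, f, rfl, hu₀⟩ := hu.eq_of_card_five h5
    obtain ⟨h, rfl, rfl⟩ := hv.eq_of_card_one (by simp at hL; omega)
    refine ⟨a, b, c, e, f, h, k, rfl, .inl ?_⟩
    rcases hu₀ with rfl | rfl
    · exact hx
    · simpa [or_comm] using hx
  · obtain ⟨a, b, c, rfl, rfl⟩ := hu.eq_of_card_three (by omega)
    obtain ⟨e, f, h, rfl, rfl⟩ := hv.eq_of_card_three (by simp at hL h23; omega)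
    exact ⟨a, b, c, e, f, h, k, rfl, .inr (by simpa using hx)⟩

theorem prod_eq_or_eq_neg_of_perm {l l' : List ℕ} (h : l.Perm l') :
    (l.map g).prod = (l'.map g).prod ∨ (l.map g).prod = -(l'.map g).prod := by
  induction h with
  | nil => simp
  | cons a _ ih => rcases ih with ih | ih <;> simp [ih]
  | swap a b l =>
    right
    simp only [List.map_cons, List.prod_cons]
    rw [← mul_assoc, ι_mul_ι_anticomm, neg_mul, mul_assoc]
  | trans _ _ ih₁ ih₂ =>
    rcases ih₁ with ih₁ | ih₁ <;> rcases ih₂ with ih₂ | ih₂ <;> simp [ih₁, ih₂]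

theorem nested_eq {a b c e f h k : ℕ} {α β : ℕ → ZMod 3}
    (hα : [a, b, c, e, f, h, k].map α = [1, 1, 1, 0, 0, 0, 0])
    (hβ : [a, b, c, e, f, h, k].map β = [1, 1, 1, 1, 1, 0, 0]) :
    ∂ (∂ (g a * g b * g c) * g e * g f) * g h * g k =
      weightedDer β (weightedDer α ([a, b, c, e, f, h, k].map g).prod) := by
  simp only [List.map_cons, List.map_nil, List.cons.injEq, and_true] at hα hβ
  simp only [List.map_cons, List.map_nil, List.prod_cons, List.prod_nil, mul_one,
    weightedDer_mul, weightedDer_gen, hα, hβ, map_add, Pi.one_apply, one_smul, zero_smul,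
    mul_zero, zero_mul, add_zero, zero_add]
  noncomm_ring

theorem disjoint_eq {a b c e f h k : ℕ} {α β : ℕ → ZMod 3}
    (hα : [a, b, c, e, f, h, k].map α = [1, 1, 1, 0, 0, 0, 0])
    (hβ : [a, b, c, e, f, h, k].map β = [0, 0, 0, 1, 1, 1, 0]) :
    ∂ (g a * g b * g c) * ∂ (g e * g f * g h) * g k =
      weightedDer β (weightedDer α ([a, b, c, e, f, h, k].map g).prod) := by
  simp only [List.map_cons, List.map_nil, List.cons.injEq, and_true] at hα hβ
  simp only [List.map_cons, List.map_nil, List.prod_cons, List.prod_nil, mul_one,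
    weightedDer_mul, weightedDer_gen, hα, hβ, map_add, Pi.one_apply, one_smul, zero_smul,
    mul_zero, zero_mul, add_zero, zero_add]
  noncomm_ring

/-- The product of the generators indexed by a list. -/
noncomputable def monomial (l : List (ℕ × ℕ)) : Gr := (l.map fun p => gen p.1 p.2).prod

theorem monomial_eq_ιMulti (l : List (ℕ × ℕ)) :
    monomial l = ιMulti (ZMod 3) l.length (fun k => Finsupp.single (l.get k) (1 : ZMod 3)) := by
  rw [ExteriorAlgebra.ιMulti_apply, monomial]
  congr 1
  conv_lhs => rw [← List.ofFn_get l, List.map_ofFn]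
  rfl

theorem monomial_ne_zero {l : List (ℕ × ℕ)} (hl : l.Nodup) : monomial l ≠ 0 := by
  rw [monomial_eq_ιMulti]
  exact ιMulti_single_ne_zero (List.nodup_iff_injective_get.1 hl)

theorem monomial_eq_zero {l : List (ℕ × ℕ)} (hl : ¬l.Nodup) : monomial l = 0 := by
  rw [monomial_eq_ιMulti]
  refine ExteriorAlgebra.ιMulti_eq_zero_of_not_inj (R := ZMod 3) fun h => hl ?_
  refine List.nodup_iff_injective_get.2 fun i j hij => h ?_
  simp only [hij]

/-- The product of the letters occurring once. -/
noncomputable def simpleProd : Gr := g 0 * g 1 * g 2 * g 3 * g 4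

/-- The product of the letters occurring once, with one factor differentiated with weights `γ`,
times `g₅ g₅'`, plus `c` times the product of the letters occurring once times `g₅ g₅''`. -/
noncomputable def normalForm (γ : ℕ → ZMod 3) (c : ZMod 3) : Gr :=
  weightedDer γ simpleProd * (gen 5 0 * gen 5 1) + c • (simpleProd * (gen 5 0 * gen 5 2))

theorem weightedDer_simpleProd (γ : ℕ → ZMod 3) :
    weightedDer γ simpleProd = γ 0 • (gen 0 1 * g 1 * g 2 * g 3 * g 4) +
      γ 1 • (g 0 * gen 1 1 * g 2 * g 3 * g 4) + γ 2 • (g 0 * g 1 * gen 2 1 * g 3 * g 4) +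
      γ 3 • (g 0 * g 1 * g 2 * gen 3 1 * g 4) + γ 4 • (g 0 * g 1 * g 2 * g 3 * gen 4 1) := by
  simp only [simpleProd, weightedDer_mul, weightedDer_gen, add_mul, smul_mul_assoc, mul_smul_comm,
    zero_add]

theorem mergeHom_weightedDer_weightedDer (α β : ℕ → ZMod 3) :
    mergeHom (weightedDer β (weightedDer α ([0, 1, 2, 3, 4, 5, 6].map g).prod)) =
      normalForm ((β 6 - β 5) • α + (α 6 - α 5) • β) (α 6 * β 6 - α 5 * β 5) := by
  have hP : ([0, 1, 2, 3, 4, 5, 6].map g).prod = simpleProd * (gen 5 0 * gen 6 0) := by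
    simp [simpleProd, mul_assoc]
  have hS : mergeHom simpleProd = simpleProd := by
    simp [simpleProd, mergeHom_gen, merge]
  have hD (a : ℕ → ZMod 3) : mergeHom (weightedDer a simpleProd) = weightedDer a simpleProd := by
    simp [weightedDer_simpleProd, mergeHom_gen, merge]
  have hswap (j : ℕ) : gen 5 (j + 1) * gen 5 0 = -(gen 5 0 * gen 5 (j + 1)) := ι_mul_ι_anticomm _ _
  have hR (a : ℕ → ZMod 3) : mergeHom (weightedDer a (gen 5 0 * gen 6 0)) =
      (a 6 - a 5) • (gen 5 0 * gen 5 1) := by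
    simp only [weightedDer_mul, weightedDer_gen, map_add, map_mul, map_smul, mergeHom_gen, merge,
      smul_mul_assoc, mul_smul_comm]
    simp only [Nat.reduceEqDiff, if_true, if_false, zero_add, hswap 0]
    module
  have hRR : mergeHom (weightedDer β (weightedDer α (gen 5 0 * gen 6 0))) =
      (α 6 * β 6 - α 5 * β 5) • (gen 5 0 * gen 5 2) := by
    simp only [weightedDer_mul, weightedDer_gen, map_add, map_mul, map_smul, mergeHom_gen, merge,
      smul_mul_assoc, mul_smul_comm]
    simp only [Nat.reduceEqDiff, if_true, if_false, zero_add, gen_mul_gen_self, hswap 1,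
      Nat.reduceAdd]
    module
  have hR0 : mergeHom (gen 5 0 * gen 6 0) = 0 := by
    simp [mergeHom_gen, merge]
  have hlin : weightedDer ((β 6 - β 5) • α + (α 6 - α 5) • β) simpleProd =
      (β 6 - β 5) • weightedDer α simpleProd + (α 6 - α 5) • weightedDer β simpleProd := by
    simp only [weightedDer_simpleProd, Pi.add_apply, Pi.smul_apply, smul_eq_mul]
    module
  rw [hP]
  generalize gen 5 0 * gen 6 0 = R at hR hRR hR0 ⊢
  simp only [weightedDer_mul, map_add, map_mul, hS, hD, hR, hRR, hR0, normalForm, hlin, mul_zero,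
    zero_add, mul_smul_comm, add_mul, smul_mul_assoc]
  module

/-- The indicator function of a list of letters. -/
def indicator (s : List ℕ) (i : ℕ) : ZMod 3 := if i ∈ s then 1 else 0

theorem map_indicator_fst {a b c e f h k : ℕ} (hn : [a, b, c, e, f, h, k].Nodup) :
    [a, b, c, e, f, h, k].map (indicator [a, b, c]) = [1, 1, 1, 0, 0, 0, 0] := by
  simp only [indicator, List.map_cons, List.map_nil]
  grind

theorem map_indicator_snd {a b c e f h k : ℕ} (hn : [a, b, c, e, f, h, k].Nodup) :
    [a, b, c, e, f, h, k].map (indicator [e, f, h]) = [0, 0, 0, 1, 1, 1, 0] := by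
  simp only [indicator, List.map_cons, List.map_nil]
  grind

theorem map_indicator_append {a b c e f h k : ℕ} (hn : [a, b, c, e, f, h, k].Nodup) :
    [a, b, c, e, f, h, k].map (indicator [a, b, c, e, f]) = [1, 1, 1, 1, 1, 0, 0] := by
  simp only [indicator, List.map_cons, List.map_nil]
  grind

theorem nested_word {a b c e f h k : ℕ}
    (hl : [a, b, c, e, f, h, k].Perm [0, 1, 2, 3, 4, 5, 6]) :
    let x := ∂ (∂ (∂ (g (merge a) * g (merge b) * g (merge c)) * g (merge e) * g (merge f)) *
      g (merge h) * g (merge k))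
    let α := indicator [a, b, c]
    let β := indicator [a, b, c, e, f]
    let y := ∂ (normalForm ((β 6 - β 5) • α + (α 6 - α 5) • β) (α 6 * β 6 - α 5 * β 5))
    x = y ∨ x = -y := by
  intro x α β y
  have hn : [a, b, c, e, f, h, k].Nodup := hl.nodup_iff.2 (by decide)
  have hx : x = mergeHom (∂ (∂ (∂ (g a * g b * g c) * g e * g f) * g h * g k)) := by
    simp only [mergeHom_weightedDer_one, map_mul, mergeHom_gen, x]
  rw [nested_eq (map_indicator_fst hn) (map_indicator_append hn), mergeHom_weightedDer_one] at hx
  have hy : y = _ := congrArg ∂ (mergeHom_weightedDer_weightedDer α β).symm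
  rw [hx, hy]
  rcases prod_eq_or_eq_neg_of_perm hl with hp | hp <;> rw [hp] <;> simp [α, β]

theorem disjoint_word {a b c e f h k : ℕ}
    (hl : [a, b, c, e, f, h, k].Perm [0, 1, 2, 3, 4, 5, 6]) :
    let x := ∂ (∂ (g (merge a) * g (merge b) * g (merge c)) *
      ∂ (g (merge e) * g (merge f) * g (merge h)) * g (merge k))
    let α := indicator [a, b, c]
    let β := indicator [e, f, h]
    let y := ∂ (normalForm ((β 6 - β 5) • α + (α 6 - α 5) • β) (α 6 * β 6 - α 5 * β 5))
    x = y ∨ x = -y := by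
  intro x α β y
  have hn : [a, b, c, e, f, h, k].Nodup := hl.nodup_iff.2 (by decide)
  have hx : x = mergeHom (∂ (∂ (g a * g b * g c) * ∂ (g e * g f * g h) * g k)) := by
    simp only [mergeHom_weightedDer_one, map_mul, mergeHom_gen, x]
  rw [disjoint_eq (map_indicator_fst hn) (map_indicator_snd hn), mergeHom_weightedDer_one] at hx
  have hy : y = _ := congrArg ∂ (mergeHom_weightedDer_weightedDer α β).symm
  rw [hx, hy]
  rcases prod_eq_or_eq_neg_of_perm hl with hp | hp <;> rw [hp] <;> simp [α, β]

/-- The weights with prescribed values at `0, 1, 2, 3` whose sum over the letters `0, …, 4`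
vanishes. -/
def sumZeroWeight (p : Fin 5 → ZMod 3) : ℕ → ZMod 3
  | 0 => p 0
  | 1 => p 1
  | 2 => p 2
  | 3 => p 3
  | 4 => -(p 0 + p 1 + p 2 + p 3)
  | _ => 0

/-- A linear parametrization of the span of the words. -/
noncomputable def wordParam : (Fin 5 → ZMod 3) →ₗ[ZMod 3] Gr where
  toFun p := ∂ (normalForm (sumZeroWeight p) (p 4))
  map_add' p q := by
    rw [← map_add]
    congr 1
    simp only [normalForm, weightedDer_simpleProd, sumZeroWeight, Pi.add_apply, add_mul,
      smul_mul_assoc]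
    module
  map_smul' c p := by
    rw [← map_smul]
    congr 1
    simp only [normalForm, weightedDer_simpleProd, sumZeroWeight, Pi.smul_apply, smul_eq_mul,
      add_mul, smul_mul_assoc, RingHom.id_apply]
    module

theorem mem_range_wordParam {γ : ℕ → ZMod 3} (c : ZMod 3)
    (hγ : γ 0 + γ 1 + γ 2 + γ 3 + γ 4 = 0) :
    ∂ (normalForm γ c) ∈ LinearMap.range wordParam := by
  refine ⟨![γ 0, γ 1, γ 2, γ 3, c], ?_⟩
  have h4 : γ 4 = -(γ 0 + γ 1 + γ 2 + γ 3) := by linear_combination hγ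
  change ∂ (normalForm _ _) = _
  simp only [normalForm, weightedDer_simpleProd, h4]
  rfl

theorem add_eq_zero_of_weightedDer_normalForm {γ : ℕ → ZMod 3} {c : ZMod 3}
    (h : ∂ (normalForm γ c) = 0) {i : ℕ} (hi : i < 5) : γ i + c = 0 := by
  have h1 : ∂ (normalForm γ c) * (gen 5 1 * gen 5 3) =
      weightedDer (fun i => γ i + c) simpleProd * (gen 5 0 * gen 5 2 * gen 5 1 * gen 5 3) := by
    have z1 : gen 5 0 * (gen 5 1 * (gen 5 1 * gen 5 3)) = 0 := by
      simpa [monomial] using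
        monomial_eq_zero (l := [(5, 0), (5, 1), (5, 1), (5, 3)]) (by decide)
    have z2 : gen 5 1 * (gen 5 2 * (gen 5 1 * gen 5 3)) = 0 := by
      simpa [monomial] using
        monomial_eq_zero (l := [(5, 1), (5, 2), (5, 1), (5, 3)]) (by decide)
    have z3 : gen 5 0 * (gen 5 3 * (gen 5 1 * gen 5 3)) = 0 := by
      simpa [monomial] using
        monomial_eq_zero (l := [(5, 0), (5, 3), (5, 1), (5, 3)]) (by decide)
    have e1 : ∂ (gen 5 0 * gen 5 1) = gen 5 0 * gen 5 2 := by
      simp only [weightedDer_mul, weightedDer_gen, Pi.one_apply, one_smul, zero_add,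
        gen_mul_gen_self, Nat.reduceAdd]
    have e2 : ∂ (gen 5 0 * gen 5 2) = gen 5 1 * gen 5 2 + gen 5 0 * gen 5 3 := by
      simp only [weightedDer_mul, weightedDer_gen, Pi.one_apply, one_smul, zero_add, Nat.reduceAdd]
    have e3 : weightedDer (fun i => γ i + c) simpleProd =
        weightedDer γ simpleProd + c • ∂ simpleProd := by
      simp only [weightedDer_simpleProd, Pi.one_apply]
      module
    rw [e3, normalForm, map_add, map_smul, weightedDer_mul _ _ (gen 5 0 * gen 5 1),
      weightedDer_mul _ _ (gen 5 0 * gen 5 2), e1, e2]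
    simp only [add_mul, mul_add, smul_mul_assoc, mul_assoc, z1, z2, z3, mul_zero, add_zero, zero_add]
  have h2 : gen i 0 * (weightedDer (fun i => γ i + c) simpleProd *
      (gen 5 0 * gen 5 2 * gen 5 1 * gen 5 3)) = 0 := by
    rw [← h1, h, zero_mul, mul_zero]
  let tail : List (ℕ × ℕ) := [(5, 0), (5, 2), (5, 1), (5, 3)]
  have h3 :
      (γ 0 + c) • monomial ((i, 0) :: (0, 1) :: (1, 0) :: (2, 0) :: (3, 0) :: (4, 0) :: tail) +
      (γ 1 + c) • monomial ((i, 0) :: (0, 0) :: (1, 1) :: (2, 0) :: (3, 0) :: (4, 0) :: tail) +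
      (γ 2 + c) • monomial ((i, 0) :: (0, 0) :: (1, 0) :: (2, 1) :: (3, 0) :: (4, 0) :: tail) +
      (γ 3 + c) • monomial ((i, 0) :: (0, 0) :: (1, 0) :: (2, 0) :: (3, 1) :: (4, 0) :: tail) +
      (γ 4 + c) • monomial ((i, 0) :: (0, 0) :: (1, 0) :: (2, 0) :: (3, 0) :: (4, 1) :: tail) =
      0 := by
    rw [← h2, weightedDer_simpleProd]
    simp only [monomial, tail, List.map_cons, List.map_nil, List.prod_cons, List.prod_nil, mul_one,
      add_mul, mul_add, smul_mul_assoc, mul_smul_comm, mul_assoc]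
  have key {x : ZMod 3} {l : List (ℕ × ℕ)} (hl : l.Nodup) (hx : x • monomial l = 0) : x = 0 :=
    (smul_eq_zero.1 hx).resolve_right (monomial_ne_zero hl)
  simp only [tail] at h3
  interval_cases i <;>
    simp (disch := decide) only [monomial_eq_zero, smul_zero, zero_add, add_zero] at h3 <;>
    exact key (by decide) h3

theorem wordParam_injective : Function.Injective wordParam := by
  refine (injective_iff_map_eq_zero _).2 fun p hp => ?_
  have h : ∀ i < 5, sumZeroWeight p i + p 4 = 0 := fun i hi =>
    add_eq_zero_of_weightedDer_normalForm hp hi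
  have h0 : p 0 + p 4 = 0 := h 0 (by decide)
  have h1 : p 1 + p 4 = 0 := h 1 (by decide)
  have h2 : p 2 + p 4 = 0 := h 2 (by decide)
  have h3 : p 3 + p 4 = 0 := h 3 (by decide)
  have h4 : -(p 0 + p 1 + p 2 + p 3) + p 4 = 0 := h 4 (by decide)
  have three : (3 : ZMod 3) = 0 := rfl
  have hp4 : p 4 = 0 := by
    linear_combination 2 * p 4 * three - (h0 + h1 + h2 + h3 + h4)
  simp only [hp4, add_zero] at h0 h1 h2 h3
  ext i
  fin_cases i <;> assumption

theorem sum_letters_of_perm {l : List ℕ} (hl : l.Perm [0, 1, 2, 3, 4, 5, 6]) (α : ℕ → ZMod 3) :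
    α 0 + α 1 + α 2 + α 3 + α 4 + α 5 + α 6 = (l.map α).sum := by
  simpa [add_assoc] using (hl.map α).sum_eq.symm

theorem sum_weight_eq_zero {α β : ℕ → ZMod 3} {s : ZMod 3}
    (hα : α 0 + α 1 + α 2 + α 3 + α 4 + α 5 + α 6 = 0)
    (hβ : β 0 + β 1 + β 2 + β 3 + β 4 + β 5 + β 6 = s)
    (h : (α 6 - α 5) * s + α 6 * β 6 - α 5 * β 5 = 0) (γ : ℕ → ZMod 3)
    (hγ : γ = (β 6 - β 5) • α + (α 6 - α 5) • β) : γ 0 + γ 1 + γ 2 + γ 3 + γ 4 = 0 := by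
  have three : (3 : ZMod 3) = 0 := rfl
  simp only [hγ, Pi.add_apply, Pi.smul_apply, smul_eq_mul]
  linear_combination (β 6 - β 5) * hα + (α 6 - α 5) * hβ + h -
    (α 6 * β 6 - α 5 * β 5) * three

theorem mem_range_of_isWord {x : Gr} (hx : IsWord x {0, 1, 2, 3, 4, 5, 5}) :
    x ∈ LinearMap.range wordParam := by
  obtain ⟨a, b, c, e, f, h, k, hL, hx⟩ := hx.eq_of_card_seven rfl
  obtain ⟨l, hl, hp⟩ : Relation.Comp (· = List.map merge ·) List.Perm [a, b, c, e, f, h, k]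
      [0, 1, 2, 3, 4, 5, 6] := by
    rw [List.eq_map_comp_perm]
    exact (Multiset.coe_eq_coe.1 hL).symm
  have hlen := hp.length_eq
  match l, hlen with
  | [a₀, b₀, c₀, e₀, f₀, h₀, k₀], _ =>
  simp only [List.map_cons, List.map_nil, List.cons.injEq, and_true] at hl
  obtain ⟨rfl, rfl, rfl, rfl, rfl, rfl, rfl⟩ := hl
  have hn : [a₀, b₀, c₀, e₀, f₀, h₀, k₀].Nodup := hp.nodup_iff.2 (by decide)
  have hα := sum_letters_of_perm hp (indicator [a₀, b₀, c₀])
  rw [map_indicator_fst hn] at hα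
  rcases hx with hx | hx
  · have hβ := sum_letters_of_perm hp (indicator [a₀, b₀, c₀, e₀, f₀])
    rw [map_indicator_append hn] at hβ
    have hsub (i : ℕ) : indicator [a₀, b₀, c₀] i * indicator [a₀, b₀, c₀, e₀, f₀] i =
        indicator [a₀, b₀, c₀] i := by
      by_cases hi : i ∈ [a₀, b₀, c₀] <;> simp [indicator, hi]
      simp only [List.mem_cons] at hi
      tauto
    have hmem := mem_range_wordParam (indicator [a₀, b₀, c₀] 6 * indicator [a₀, b₀, c₀, e₀, f₀] 6 -
      indicator [a₀, b₀, c₀] 5 * indicator [a₀, b₀, c₀, e₀, f₀] 5)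
      (sum_weight_eq_zero (s := -1) hα hβ (by rw [hsub, hsub]; ring) _ rfl)
    rcases nested_word hp with hw | hw <;> rcases hx with rfl | rfl <;> rw [hw] <;> simpa using hmem
  · have hβ := sum_letters_of_perm hp (indicator [e₀, f₀, h₀])
    rw [map_indicator_snd hn] at hβ
    have hdisj (i : ℕ) : indicator [a₀, b₀, c₀] i * indicator [e₀, f₀, h₀] i = 0 := by
      simp only [indicator]
      grind
    have hmem := mem_range_wordParam (indicator [a₀, b₀, c₀] 6 * indicator [e₀, f₀, h₀] 6 -
      indicator [a₀, b₀, c₀] 5 * indicator [e₀, f₀, h₀] 5)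
      (sum_weight_eq_zero (s := 0) hα hβ (by rw [hdisj, hdisj]; ring) _ rfl)
    rcases disjoint_word hp with hw | hw <;> rcases hx with rfl | rfl <;> rw [hw] <;>
      simpa using hmem

/-- The span of the words in `g₀, …, g₄` (once each) and `g₅` (twice). -/
noncomputable def wordSpan : Submodule (ZMod 3) Gr :=
  Submodule.span (ZMod 3) {x | IsWord x {0, 1, 2, 3, 4, 5, 5}}

theorem mem_wordSpan_of_eq_or_eq_neg {x y : Gr} (hx : IsWord (-x) {0, 1, 2, 3, 4, 5, 5})
    (h : x = y ∨ x = -y) : y ∈ wordSpan := by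
  have hmem : x ∈ wordSpan := (Submodule.neg_mem_iff _).1 (Submodule.subset_span hx)
  rcases h with rfl | rfl
  · exact hmem
  · exact (Submodule.neg_mem_iff _).1 hmem

theorem coe_map_merge_of_perm {l : List ℕ} (hl : l.Perm [0, 1, 2, 3, 4, 5, 6]) :
    ({0, 1, 2, 3, 4, 5, 5} : Multiset ℕ) = ↑(l.map merge) :=
  (Multiset.coe_eq_coe.2 (hl.map merge)).symm

theorem isWord_disjoint (a b c e f h k : ℕ) :
    IsWord (-∂ (∂ (g a * g b * g c) * ∂ (g e * g f * g h) * g k)) ↑[a, b, c, e, f, h, k] := by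
  have := IsWord3.node (g := g) (T := fun a b c => -∂ (a * b * c))
    (.node (.letter a) (.letter b) (.letter c)) (.node (.letter e) (.letter f) (.letter h))
    (.letter k)
  simp only [neg_mul_neg] at this
  exact this

theorem isWord_nested (a b c e f h k : ℕ) :
    IsWord (-∂ (∂ (∂ (g a * g b * g c) * g e * g f) * g h * g k)) ↑[a, b, c, e, f, h, k] := by
  have := IsWord3.node (g := g) (T := fun a b c => -∂ (a * b * c))
    (.node (.node (.letter a) (.letter b) (.letter c)) (.letter e) (.letter f)) (.letter h)
    (.letter k)
  simp only [neg_mul, map_neg, neg_neg] at this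
  exact this

theorem normalForm_mem_wordSpan_of_disjoint {i j k l m : ℕ}
    (hl : [i, j, k, l, m, 6, 5].Perm [0, 1, 2, 3, 4, 5, 6]) :
    ∂ (normalForm (indicator [i, j, k]) 0) ∈ wordSpan := by
  have hn : [i, j, k, l, m, 6, 5].Nodup := hl.nodup_iff.2 (by decide)
  have h₁ : indicator [i, j, k] 5 = 0 := by simp only [indicator]; grind
  have h₂ : indicator [i, j, k] 6 = 0 := by simp only [indicator]; grind
  have h₃ : indicator [l, m, 6] 5 = 0 := by simp only [indicator]; grind
  have h₄ : indicator [l, m, 6] 6 = 1 := by simp [indicator]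
  have hw := disjoint_word hl
  simp only [h₁, h₂, h₃, h₄, sub_zero, one_smul, zero_smul, add_zero, zero_mul] at hw
  refine mem_wordSpan_of_eq_or_eq_neg ?_ hw
  rw [coe_map_merge_of_perm hl]
  exact isWord_disjoint ..

theorem normalForm_mem_wordSpan_of_nested {i j k l m : ℕ}
    (hl : [i, j, 6, k, 5, l, m].Perm [0, 1, 2, 3, 4, 5, 6]) :
    ∂ (normalForm (indicator [i, j, 6, k, 5]) 1) ∈ wordSpan := by
  have hn : [i, j, 6, k, 5, l, m].Nodup := hl.nodup_iff.2 (by decide)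
  have h₁ : indicator [i, j, 6] 5 = 0 := by simp only [indicator]; grind
  have h₂ : indicator [i, j, 6] 6 = 1 := by simp [indicator]
  have h₃ : indicator [i, j, 6, k, 5] 5 = 1 := by simp [indicator]
  have h₄ : indicator [i, j, 6, k, 5] 6 = 1 := by simp [indicator]
  have hw := nested_word hl
  simp only [h₁, h₂, h₃, h₄, sub_zero, sub_self, one_smul, zero_smul, zero_add,
    mul_one] at hw
  refine mem_wordSpan_of_eq_or_eq_neg ?_ hw
  rw [coe_map_merge_of_perm hl]
  exact isWord_nested ..

theorem wordParam_mem_wordSpan (p : Fin 5 → ZMod 3) : wordParam p ∈ wordSpan := by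
  have hp : wordParam p =
      p 0 • (∂ (normalForm (indicator [0, 1, 2]) 0) - ∂ (normalForm (indicator [4, 1, 2]) 0)) +
      p 1 • (∂ (normalForm (indicator [1, 0, 2]) 0) - ∂ (normalForm (indicator [4, 0, 2]) 0)) +
      p 2 • (∂ (normalForm (indicator [2, 0, 1]) 0) - ∂ (normalForm (indicator [4, 0, 1]) 0)) +
      p 3 • (∂ (normalForm (indicator [3, 0, 1]) 0) - ∂ (normalForm (indicator [4, 0, 1]) 0)) +
      p 4 • (∂ (normalForm (indicator [0, 1, 6, 2, 5]) 1) -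
        ∂ (normalForm (indicator [0, 1, 2]) 0)) := by
    change ∂ (normalForm _ _) = _
    simp only [← map_sub, ← map_smul, ← map_add]
    congr 1
    simp [normalForm, weightedDer_simpleProd, sumZeroWeight, indicator, add_mul]
    module
  rw [hp]
  refine add_mem (add_mem (add_mem (add_mem ?_ ?_) ?_) ?_) ?_ <;>
    refine Submodule.smul_mem _ _ (sub_mem ?_ ?_)
  · exact normalForm_mem_wordSpan_of_disjoint (l := 3) (m := 4) (by decide)
  · exact normalForm_mem_wordSpan_of_disjoint (l := 0) (m := 3) (by decide)
  · exact normalForm_mem_wordSpan_of_disjoint (l := 3) (m := 4) (by decide)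
  · exact normalForm_mem_wordSpan_of_disjoint (l := 1) (m := 3) (by decide)
  · exact normalForm_mem_wordSpan_of_disjoint (l := 3) (m := 4) (by decide)
  · exact normalForm_mem_wordSpan_of_disjoint (l := 2) (m := 3) (by decide)
  · exact normalForm_mem_wordSpan_of_disjoint (l := 2) (m := 4) (by decide)
  · exact normalForm_mem_wordSpan_of_disjoint (l := 2) (m := 3) (by decide)
  · exact normalForm_mem_wordSpan_of_nested (l := 3) (m := 4) (by decide)
  · exact normalForm_mem_wordSpan_of_disjoint (l := 3) (m := 4) (by decide)

theorem wordSpan_eq_range : wordSpan = LinearMap.range wordParam := by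
  refine le_antisymm (Submodule.span_le.2 fun x hx => mem_range_of_isWord hx) ?_
  rintro _ ⟨p, rfl⟩
  exact wordParam_mem_wordSpan p

/-- the `𝔽₃`-span of all 3-words in the letters g₀,…,g₄ (once each) and g₅ (twice)
has dimension `5`. -/
theorem stmt_8 (d : Gr →ₗ[ZMod 3] Gr)
    (hLeib : ∀ u v : Gr, d (u * v) = d u * v + u * d v)
    (hd : ∀ i j : ℕ, d (gen i j) = gen i (j + 1)) :
    Module.finrank (ZMod 3)
      ↥(Submodule.span (ZMod 3)
        {x : Gr | IsWord3 g (fun a b c => -d (a * b * c)) x (({0, 1, 2, 3, 4, 5, 5} : Multiset ℕ))}) = 5 := by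
  obtain rfl := eq_weightedDer_one hLeib hd
  change Module.finrank (ZMod 3) wordSpan = 5
  rw [wordSpan_eq_range, LinearMap.finrank_range_of_inj wordParam_injective]
  simp
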